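/- For n ≥ 2, let a_n = ∑_{σ ∈ D_n} q^{exc^Abs(σ)} (−1)^{cyc(σ)} and b_n = ∑_{σ ∈ D_n^c} q^{exc^Abs(σ)} (−1)^{cyc(σ)}, where D_n^c = G_{2,n} \ D_n is the set of odd signed permutations. Then in ℤ[q]: a_n = (q − 1)(a_{n−1} + q·b_{n−1}) and b_n = (q − 1)(b_{n−1} + q·a_{n−1}). -/

import Mathlib

open Finset Polynomial

/-- Number of excedances of a permutation: #{i : τ(i) > i}. -/
def exc {n : ℕ} (τ : Equiv.Perm (Fin n)) : ℕ :=
  (Finset.univ.filter fun i => i < τ i).card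

/-- Number of cycles of a permutation, counting fixed points as cycles. -/
def cyc {n : ℕ} (τ : Equiv.Perm (Fin n)) : ℕ :=
  Multiset.card τ.cycleType + (Finset.univ.filter fun i => τ i = i).card

/-- Color sum of a colored permutation. -/
def csum {r n : ℕ} (z : Fin n → Fin r) : ℕ := ∑ i, (z i : ℕ)

/-- #{i : z_i = 0 and τ(i) > i}. -/
def excA {r n : ℕ} (z : Fin n → Fin r) (τ : Equiv.Perm (Fin n)) : ℕ :=
  (Finset.univ.filter fun i => (z i : ℕ) = 0 ∧ i < τ i).card

/-- Excedance number with respect to the absolute order. -/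
def excAbs {r n : ℕ} (z : Fin n → Fin r) (τ : Equiv.Perm (Fin n)) : ℕ :=
  exc τ + csum z

/-- Excedance number with respect to the color order. -/
def excClr {r n : ℕ} (z : Fin n → Fin r) (τ : Equiv.Perm (Fin n)) : ℕ :=
  r * excA z τ + csum z

/-- Generating function over the even signed permutations $D_n$. -/
noncomputable def aD (n : ℕ) : Polynomial ℤ :=
  ∑ σ ∈ Finset.univ.filter
      (fun σ : (Fin n → Fin 2) × Equiv.Perm (Fin n) => Even (csum σ.1)),
    (X : Polynomial ℤ) ^ excAbs σ.1 σ.2 * (-1) ^ cyc σ.2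

/-- Generating function over the odd signed permutations $D_n^c$. -/
noncomputable def bD (n : ℕ) : Polynomial ℤ :=
  ∑ σ ∈ Finset.univ.filter
      (fun σ : (Fin n → Fin 2) × Equiv.Perm (Fin n) => ¬ Even (csum σ.1)),
    (X : Polynomial ℤ) ^ excAbs σ.1 σ.2 * (-1) ^ cyc σ.2

/-- The sign of a permutation in terms of its number of cycles. -/
theorem neg_one_pow_cyc {n : ℕ} (τ : Equiv.Perm (Fin n)) :
    (-1 : Polynomial ℤ) ^ cyc τ = (-1) ^ n * ((Equiv.Perm.sign τ : ℤ) : Polynomial ℤ) := by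
  have h1 : τ.cycleType.sum + (univ.filter fun i => τ i = i).card = n := by
    rw [Equiv.Perm.sum_cycleType, add_comm]
    have h2 := Finset.card_filter_add_card_filter_not (s := (univ : Finset (Fin n)))
      (fun i => τ i = i)
    rwa [Finset.card_univ, Fintype.card_fin] at h2
  rw [Equiv.Perm.sign_of_cycleType, cyc]
  push_cast
  rw [← pow_add]
  generalize (univ.filter fun i => τ i = i).card = f at *
  rw [show n + (τ.cycleType.sum + τ.cycleType.card) =
    2 * τ.cycleType.sum + (τ.cycleType.card + f) by omega, pow_add _ (2 * _), pow_mul]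
  simp

/-- The matrix with entries `X` below the diagonal and `1` elsewhere. -/
noncomputable def excMatrix (n : ℕ) : Matrix (Fin n) (Fin n) (Polynomial ℤ) :=
  fun i j => if j < i then X else 1

theorem det_excMatrix_succ (n : ℕ) : (excMatrix (n + 1)).det = (1 - X) ^ n := by
  let B : Matrix (Fin (n + 1)) (Fin (n + 1)) (Polynomial ℤ) := fun i j =>
    Fin.cases (excMatrix (n + 1) i 0) (fun k => if i = k.succ then 1 - X else 0) j
  rw [Matrix.det_eq_of_forall_col_eq_smul_add_pred (A := excMatrix (n + 1)) (B := B)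
      (fun _ => 1) (fun _ => rfl), Matrix.det_of_isLowerTriangular]
  · simp [B, Fin.prod_univ_succ, excMatrix]
  · intro i j hij
    have hij : i < j := hij
    cases j using Fin.cases with
    | zero => exact absurd hij (Fin.not_lt_zero i)
    | succ k => simp [B, hij.ne]
  · intro i j
    simp only [B, excMatrix, Fin.cases_succ, one_mul, Fin.lt_def, Fin.ext_iff, Fin.val_succ,
      Fin.val_castSucc]
    split_ifs <;> first | omega | ring

/-- The generating function of `exc` over permutations, signed by the number of cycles. -/
noncomputable def signedExcPoly (n : ℕ) : Polynomial ℤ :=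
  ∑ τ : Equiv.Perm (Fin n), X ^ exc τ * (-1) ^ cyc τ

theorem signedExcPoly_eq_det (n : ℕ) : signedExcPoly n = (-1) ^ n * (excMatrix n).det := by
  rw [signedExcPoly, Matrix.det_apply', Finset.mul_sum]
  refine Finset.sum_congr rfl fun τ _ => ?_
  have h : ∏ i, excMatrix n (τ i) i = X ^ exc τ := by
    simp [excMatrix, exc, Finset.prod_ite]
  rw [h, neg_one_pow_cyc]
  ring

theorem signedExcPoly_succ_succ (n : ℕ) :
    signedExcPoly (n + 2) = (X - 1) * signedExcPoly (n + 1) := by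
  simp only [signedExcPoly_eq_det, det_excMatrix_succ]
  ring

/-- The part of `(1 + X) ^ n`, expanded over color vectors, with color sum satisfying `p`. -/
noncomputable def colorPoly (p : ℕ → Prop) [DecidablePred p] (n : ℕ) : Polynomial ℤ :=
  ∑ z : Fin n → Fin 2 with p (csum z), X ^ csum z

theorem colorPoly_succ (p : ℕ → Prop) [DecidablePred p] (n : ℕ) :
    colorPoly p (n + 1) = colorPoly p n + X * colorPoly (fun k => p (k + 1)) n := by
  simp only [colorPoly, Finset.sum_filter, Finset.mul_sum, mul_ite, mul_zero]
  rw [← (Fin.consEquiv fun _ : Fin (n + 1) => Fin 2).sum_comp, Fintype.sum_prod_type,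
    Fin.sum_univ_two]
  simp [Fin.consEquiv, csum, Fin.sum_univ_succ, add_comm 1, pow_succ']
  rfl

theorem sum_filter_csum_eq_mul (p : ℕ → Prop) [DecidablePred p] (n : ℕ) :
    (∑ σ : (Fin n → Fin 2) × Equiv.Perm (Fin n) with p (csum σ.1),
      (X : Polynomial ℤ) ^ excAbs σ.1 σ.2 * (-1) ^ cyc σ.2) =
      colorPoly p n * signedExcPoly n := by
  rw [colorPoly, signedExcPoly, Finset.sum_filter, Fintype.sum_prod_type, Finset.sum_mul_sum,
    Finset.sum_filter]
  refine Finset.sum_congr rfl fun z _ => ?_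
  split_ifs
  · refine Finset.sum_congr rfl fun τ _ => ?_
    rw [excAbs]
    ring
  · simp

theorem aD_eq (n : ℕ) : aD n = colorPoly Even n * signedExcPoly n :=
  sum_filter_csum_eq_mul _ n

theorem bD_eq (n : ℕ) : bD n = colorPoly (fun k => ¬ Even k) n * signedExcPoly n :=
  sum_filter_csum_eq_mul (fun k => ¬ Even k) n

theorem stmt14 (n : ℕ) (hn : 2 ≤ n) :
    aD n = ((X : Polynomial ℤ) - 1) * (aD (n - 1) + (X : Polynomial ℤ) * bD (n - 1)) ∧
    bD n = ((X : Polynomial ℤ) - 1) * (bD (n - 1) + (X : Polynomial ℤ) * aD (n - 1)) := by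
  obtain ⟨m, rfl⟩ := Nat.exists_eq_add_of_le' hn
  simp only [aD_eq, bD_eq, Nat.add_succ_sub_one, signedExcPoly_succ_succ,
    colorPoly_succ _ (m + 1), Nat.even_add_one, not_not]
  constructor <;> ring
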